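/- arXiv:2203.01110 — 6 statements merged into one kernel-verified Lean document; each statement's English description precedes it below -/
import Mathlib

section
/- (Theorem 1.) Let p_d be a probability density on ℝ^n, let g : ℝ^n → ℝ^k be measurable (the Fisher score x ↦ ∇_θ log p_θ(x) at θ = θ*), and let I_F be an invertible real k×k matrix (the Fisher information). Define w(x) := ‖I_F⁻¹ g(x)‖ (Euclidean norm) and assume 0 < Z := ∫ w(x) p_d(x) dx < ∞. Then p_n^opt(x) := w(x) p_d(x)/Z is a probability density, and for every probability density p_n with p_n(x) > 0 for almost every x with w(x) p_d(x) > 0, one has ∫ w(x)² p_d(x)²/p_n(x) dx ≥ ∫ w(x)² p_d(x)²/p_n^opt(x) dx = Z². Thus p_n^opt(x) ∝ p_d(x) ‖g(x)‖_{I_F^{-2}} minimizes over noise densities the noise-dependent term of the asymptotic NCE mean-squared error, both in the all-noise limit ν → ∞ and in the limit where the noise is an infinitesimal perturbation of the data distribution. -/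
open MeasureTheory Matrix

/-- A probability density on ℝ^n: a nonnegative Lebesgue-measurable function whose
Lebesgue integral equals 1. -/
def IsProbDensity {n : ℕ} (p : (Fin n → ℝ) → ℝ) : Prop :=
  Measurable p ∧ (∀ x, 0 ≤ p x) ∧ ∫⁻ x, ENNReal.ofReal (p x) = 1

/-- Cauchy–Schwarz for a probability density `p`: `(∫ f)² ≤ ∫ f² / p`. -/
theorem ofReal_sq_le_lintegral_sq_div {α : Type*} [MeasurableSpace α] {μ : Measure α}
    {f p : α → ℝ} {Z : ℝ} (hf : Measurable f) (hf0 : ∀ x, 0 ≤ f x)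
    (hp : Measurable p) (hp0 : ∀ x, 0 ≤ p x) (hZ : 0 ≤ Z)
    (hfZ : ∫⁻ x, ENNReal.ofReal (f x) ∂μ = ENNReal.ofReal Z)
    (hp1 : ∫⁻ x, ENNReal.ofReal (p x) ∂μ = 1)
    (hpos : ∀ᵐ x ∂μ, 0 < f x → 0 < p x) :
    ENNReal.ofReal (Z ^ 2) ≤ ∫⁻ x, ENNReal.ofReal (f x ^ 2 / p x) ∂μ := by
  have pointwise : ∀ᵐ x ∂μ, ENNReal.ofReal (2 * Z) * ENNReal.ofReal (f x) ≤
      ENNReal.ofReal (f x ^ 2 / p x) + ENNReal.ofReal (Z ^ 2) * ENNReal.ofReal (p x) := by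
    filter_upwards [hpos] with x hx
    have hpx := hp0 x
    rw [← ENNReal.ofReal_mul (by positivity), ← ENNReal.ofReal_mul (by positivity),
      ← ENNReal.ofReal_add (by positivity) (by positivity)]
    apply ENNReal.ofReal_le_ofReal
    rcases (hf0 x).eq_or_lt with h | h
    · rw [← h]
      simp only [mul_zero]
      positivity
    · have hpx := hx h
      have key : f x ^ 2 / p x + Z ^ 2 * p x - 2 * Z * f x = (f x - Z * p x) ^ 2 / p x := by
        field_simp
        ring
      have : 0 ≤ (f x - Z * p x) ^ 2 / p x := by positivity
      linarith
  have integrated := lintegral_mono_ae pointwise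
  rw [lintegral_const_mul _ hf.ennreal_ofReal,
    lintegral_add_right _ (hp.ennreal_ofReal.const_mul _),
    lintegral_const_mul _ hp.ennreal_ofReal, hfZ, hp1, mul_one,
    ← ENNReal.ofReal_mul (by positivity),
    show 2 * Z * Z = Z ^ 2 + Z ^ 2 by ring,
    ENNReal.ofReal_add (by positivity) (by positivity)] at integrated
  exact (ENNReal.add_le_add_iff_right ENNReal.ofReal_ne_top).1 integrated

/-- Theorem 1 of the paper: with `w x = ‖I_F⁻¹ g x‖` (Euclidean norm) and
`Z = ∫ w pd ∈ (0, ∞)`, the density `pnOpt = w pd / Z` is a probability density and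
minimizes the noise-dependent term `pn ↦ ∫ w² pd²/pn` of the asymptotic NCE MSE
(in the all-noise limit `ν → ∞` and in the infinitesimal-perturbation limit),
with minimal value `Z²`. Division by zero is interpreted as `0`. -/
theorem stmt_2 {n k : ℕ} (p_d : (Fin n → ℝ) → ℝ) (hpd : IsProbDensity p_d)
    (g : (Fin n → ℝ) → Fin k → ℝ) (hg : Measurable g)
    (I_F : Matrix (Fin k) (Fin k) ℝ) (hIF : IsUnit I_F.det)
    (w : (Fin n → ℝ) → ℝ)
    (hw : ∀ x, w x = Real.sqrt (∑ i, (I_F⁻¹.mulVec (g x) i) ^ 2))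
    (hint : Integrable (fun x => w x * p_d x))
    (Z : ℝ) (hZdef : Z = ∫ x, w x * p_d x) (hZpos : 0 < Z) :
    IsProbDensity (fun x => w x * p_d x / Z) ∧
    (∫⁻ x, ENNReal.ofReal (w x ^ 2 * p_d x ^ 2 / (w x * p_d x / Z)))
      = ENNReal.ofReal (Z ^ 2) ∧
    ∀ p_n : (Fin n → ℝ) → ℝ, IsProbDensity p_n →
      (∀ᵐ x ∂volume, 0 < w x * p_d x → 0 < p_n x) →
      (∫⁻ x, ENNReal.ofReal (w x ^ 2 * p_d x ^ 2 / (w x * p_d x / Z)))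
        ≤ ∫⁻ x, ENNReal.ofReal (w x ^ 2 * p_d x ^ 2 / p_n x) := by
  obtain ⟨hpm, hp0, -⟩ := hpd
  have hw0 : ∀ x, 0 ≤ w x := fun x => by rw [hw]; positivity
  have hwm : Measurable w := by
    rw [funext hw]
    refine Measurable.sqrt (Finset.measurable_sum _ fun i _ => Measurable.pow_const ?_ 2)
    simp only [Matrix.mulVec, dotProduct]
    fun_prop
  have hfm : Measurable fun x => w x * p_d x := hwm.mul hpm
  have hf0 : ∀ x, 0 ≤ w x * p_d x := fun x => mul_nonneg (hw0 x) (hp0 x)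
  have hfZ : ∫⁻ x, ENNReal.ofReal (w x * p_d x) = ENNReal.ofReal Z := by
    rw [hZdef, ofReal_integral_eq_lintegral_ofReal hint (Filter.Eventually.of_forall hf0)]
  have hopt : ∫⁻ x, ENNReal.ofReal (w x ^ 2 * p_d x ^ 2 / (w x * p_d x / Z))
      = ENNReal.ofReal (Z ^ 2) := by
    have h : ∀ x, ENNReal.ofReal (w x ^ 2 * p_d x ^ 2 / (w x * p_d x / Z))
        = ENNReal.ofReal Z * ENNReal.ofReal (w x * p_d x) := fun x => by
      rw [← ENNReal.ofReal_mul hZpos.le, ← mul_pow]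
      congr 1
      rcases (hf0 x).eq_or_lt with h | h
      · simp [← h]
      · generalize w x * p_d x = f at h ⊢
        field_simp
    simp_rw [h]
    rw [lintegral_const_mul _ hfm.ennreal_ofReal, hfZ, ← ENNReal.ofReal_mul hZpos.le, sq]
  refine ⟨⟨hfm.div_const Z, fun x => div_nonneg (hf0 x) hZpos.le, ?_⟩, hopt, ?_⟩
  · simp_rw [div_eq_inv_mul, ENNReal.ofReal_mul (inv_nonneg.2 hZpos.le)]
    rw [lintegral_const_mul _ hfm.ennreal_ofReal, hfZ,
      ← ENNReal.ofReal_mul (inv_nonneg.2 hZpos.le), inv_mul_cancel₀ hZpos.ne', ENNReal.ofReal_one]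
  · intro p_n ⟨hnm, hn0, hn1⟩ hpos
    rw [hopt]
    simp_rw [← mul_pow]
    exact ofReal_sq_le_lintegral_sq_div hfm hf0 hnm hn0 hZpos.le hfZ hn1 hpos
end

section
/- (Theorem 2.) Let p_d be a probability density on ℝ^n, let g : ℝ^n → ℝ^k be measurable (the Fisher score), and let I_F be a symmetric positive-definite real k×k matrix (the Fisher information). Define w(x) := √(g(x)ᵀ I_F⁻¹ g(x)) and assume 0 < Z := ∫ w(x) p_d(x) dx < ∞. Then p_n^opt(x) := w(x) p_d(x)/Z is a probability density, and for every probability density p_n with p_n(x) > 0 for almost every x with w(x) p_d(x) > 0, one has ∫ g(x)ᵀ I_F⁻¹ g(x) · p_d(x)²/p_n(x) dx ≥ Z², with equality for p_n = p_n^opt. Thus p_n^opt ∝ p_d ‖g‖_{I_F^{-1}} minimizes, in the same two limits as Theorem 1, the noise-dependent term of the expected Kullback-Leibler estimation error. -/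
open MeasureTheory Matrix

/-- The lower bound `(∫ f)² ≤ ∫ f² / p` for nonnegative integrable `f` and a density `p`
that is positive almost everywhere on `{f > 0}`, from `2 Z f ≤ f² / p + Z² p`. -/
theorem ofReal_sq_integral_le_lintegral_sq_div {α : Type*} [MeasurableSpace α] {μ : Measure α}
    {f p : α → ℝ} (hf : Integrable f μ) (hf0 : ∀ x, 0 ≤ f x)
    (hp : Measurable p) (hp0 : ∀ x, 0 ≤ p x) (hp1 : ∫⁻ x, ENNReal.ofReal (p x) ∂μ = 1)
    (hpos : ∀ᵐ x ∂μ, 0 < f x → 0 < p x) :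
    ENNReal.ofReal ((∫ x, f x ∂μ) ^ 2) ≤ ∫⁻ x, ENNReal.ofReal (f x ^ 2 / p x) ∂μ := by
  set Z := ∫ x, f x ∂μ with hZ
  have hZ0 : 0 ≤ Z := integral_nonneg hf0
  have tangent : ∀ᵐ x ∂μ, 2 * Z * f x ≤ f x ^ 2 / p x + Z ^ 2 * p x := by
    filter_upwards [hpos] with x hx
    rcases (hf0 x).eq_or_lt with h | h
    · rw [← h]
      simpa using mul_nonneg (sq_nonneg Z) (hp0 x)
    · have hpx := hx h
      have : f x ^ 2 / p x + Z ^ 2 * p x - 2 * Z * f x = (f x - Z * p x) ^ 2 / p x := by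
        field_simp
        ring
      have : 0 ≤ (f x - Z * p x) ^ 2 / p x := by positivity
      linarith
  have hleft : ∫⁻ x, ENNReal.ofReal (2 * Z * f x) ∂μ = ENNReal.ofReal (Z ^ 2 + Z ^ 2) := by
    rw [← ofReal_integral_eq_lintegral_ofReal (hf.const_mul _)
      (.of_forall fun x => mul_nonneg (by positivity) (hf0 x)), integral_const_mul, ← hZ]
    congr 1
    ring
  have hright : ∫⁻ x, ENNReal.ofReal (Z ^ 2 * p x) ∂μ = ENNReal.ofReal (Z ^ 2) := by
    simp_rw [ENNReal.ofReal_mul (sq_nonneg Z)]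
    rw [lintegral_const_mul _ hp.ennreal_ofReal, hp1, mul_one]
  refine ENNReal.le_of_add_le_add_right (ENNReal.ofReal_ne_top (r := Z ^ 2)) ?_
  rw [← ENNReal.ofReal_add (sq_nonneg Z) (sq_nonneg Z), ← hleft]
  calc ∫⁻ x, ENNReal.ofReal (2 * Z * f x) ∂μ
      ≤ ∫⁻ x, (ENNReal.ofReal (f x ^ 2 / p x) + ENNReal.ofReal (Z ^ 2 * p x)) ∂μ := by
        refine lintegral_mono_ae ?_
        filter_upwards [tangent] with x hx
        exact (ENNReal.ofReal_le_ofReal hx).trans ENNReal.ofReal_add_le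
    _ = ∫⁻ x, ENNReal.ofReal (f x ^ 2 / p x) ∂μ + ENNReal.ofReal (Z ^ 2) := by
        rw [lintegral_add_right _ (hp.const_mul _).ennreal_ofReal, hright]

/-- Theorem 2 of the paper: with `w x = √(g(x)ᵀ I_F⁻¹ g(x))` for symmetric positive
definite `I_F`, and `Z = ∫ w pd ∈ (0, ∞)`, the density `pnOpt = w pd / Z` is a
probability density and minimizes `pn ↦ ∫ (gᵀ I_F⁻¹ g) pd²/pn` (the noise-dependent term
of the expected KL estimation error in the all-noise and infinitesimal-perturbation
limits) over probability densities positive a.e. on `{w pd > 0}`, with value `Z²` at the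
optimum. Division by zero is interpreted as `0`. -/
theorem stmt_3 {n k : ℕ} (p_d : (Fin n → ℝ) → ℝ) (hpd : IsProbDensity p_d)
    (g : (Fin n → ℝ) → Fin k → ℝ) (hg : Measurable g)
    (I_F : Matrix (Fin k) (Fin k) ℝ) (hIF : I_F.PosDef)
    (w : (Fin n → ℝ) → ℝ)
    (hw : ∀ x, w x = Real.sqrt (g x ⬝ᵥ I_F⁻¹.mulVec (g x)))
    (hint : Integrable (fun x => w x * p_d x))
    (Z : ℝ) (hZdef : Z = ∫ x, w x * p_d x) (hZpos : 0 < Z) :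
    IsProbDensity (fun x => w x * p_d x / Z) ∧
    (∫⁻ x, ENNReal.ofReal ((g x ⬝ᵥ I_F⁻¹.mulVec (g x)) * p_d x ^ 2 / (w x * p_d x / Z)))
      = ENNReal.ofReal (Z ^ 2) ∧
    ∀ p_n : (Fin n → ℝ) → ℝ, IsProbDensity p_n →
      (∀ᵐ x ∂volume, 0 < w x * p_d x → 0 < p_n x) →
      ENNReal.ofReal (Z ^ 2)
        ≤ ∫⁻ x, ENNReal.ofReal ((g x ⬝ᵥ I_F⁻¹.mulVec (g x)) * p_d x ^ 2 / p_n x) := by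
  obtain ⟨hpd_meas, hpd0, -⟩ := hpd
  have hquad0 : ∀ x, 0 ≤ g x ⬝ᵥ I_F⁻¹.mulVec (g x) := fun x => by
    simpa using hIF.inv.posSemidef.dotProduct_mulVec_nonneg (g x)
  have hw_sq : ∀ x, g x ⬝ᵥ I_F⁻¹.mulVec (g x) = w x ^ 2 := fun x => by
    rw [hw, Real.sq_sqrt (hquad0 x)]
  have hf0 : ∀ x, 0 ≤ w x * p_d x := fun x =>
    mul_nonneg (hw x ▸ Real.sqrt_nonneg _) (hpd0 x)
  have hw_meas : Measurable w := by
    have hcont : Continuous fun v : Fin k → ℝ => √(v ⬝ᵥ I_F⁻¹.mulVec v) := by fun_prop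
    rw [funext hw]
    exact hcont.measurable.comp hg
  have hlint : ∫⁻ x, ENNReal.ofReal (w x * p_d x) = ENNReal.ofReal Z := by
    rw [hZdef, ofReal_integral_eq_lintegral_ofReal hint (.of_forall hf0)]
  have hf_meas : Measurable fun x => ENNReal.ofReal (w x * p_d x) :=
    (hw_meas.mul hpd_meas).ennreal_ofReal
  simp_rw [hw_sq, ← mul_pow]
  refine ⟨⟨(hw_meas.mul hpd_meas).div_const Z, fun x => div_nonneg (hf0 x) hZpos.le, ?_⟩,
    ?_, fun p_n hpn hpos => ?_⟩
  · simp_rw [ENNReal.ofReal_div_of_pos hZpos, div_eq_mul_inv]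
    rw [lintegral_mul_const _ hf_meas, hlint]
    exact ENNReal.mul_inv_cancel (by simpa using hZpos) ENNReal.ofReal_ne_top
  · have hopt : ∀ x, (w x * p_d x) ^ 2 / (w x * p_d x / Z) = Z * (w x * p_d x) := fun x => by
      rcases eq_or_ne (w x * p_d x) 0 with h | h
      · simp [h]
      · generalize w x * p_d x = a at h
        field_simp
    simp_rw [hopt, ENNReal.ofReal_mul hZpos.le (q := w _ * p_d _)]
    rw [lintegral_const_mul _ hf_meas, hlint, ← ENNReal.ofReal_mul hZpos.le, sq]
  · obtain ⟨hpn_meas, hpn0, hpn1⟩ := hpn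
    rw [hZdef]
    exact ofReal_sq_integral_le_lintegral_sq_div hint hf0 hpn_meas hpn0 hpn1 hpos
end

section
/- Let p_d be a probability density on ℝ^n and h : ℝ^n → ℝ a nonnegative measurable function with ∫ h(x)² p_d(x) dx < ∞ and Z := ∫ h(x) p_d(x) dx > 0. Then ∫ h(x)² p_d(x) dx − (∫ h(x) p_d(x) dx)² equals the variance of h(X) for X distributed with density p_d, this quantity is nonnegative, and it equals 0 if and only if h(x) = Z for almost every x with respect to the measure with density p_d. Consequently, the gap ΔMSE = J(p_d) − J(p_n^opt) between the NCE noise criterion J(p_n) = ∫ h² p_d²/p_n evaluated at the data distribution p_n = p_d and at the optimal noise p_n^opt = h p_d/Z equals Var_{X∼p_d}(h(X)), and is strictly positive unless h is p_d-almost-everywhere constant. -/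
open MeasureTheory ProbabilityTheory

/-- The MSE gap: `∫ h² pd − (∫ h pd)²` is the variance of `h` under the measure with
density `pd`, it is nonnegative, vanishing iff `h = Z` a.e. w.r.t. that measure; and the
gap `ΔMSE = J(pd) − J(pnOpt)` between the NCE noise criterion `J(pn) = ∫ h² pd²/pn`
at `pn = pd` and at the optimal noise `pnOpt = h pd / Z` equals this variance, being
strictly positive unless `h` is `pd`-a.e. constant. Division by zero is interpreted
as `0`. -/
theorem stmt_4 {n : ℕ} (p_d h : (Fin n → ℝ) → ℝ)
    (hpd : IsProbDensity p_d)
    (hh_meas : Measurable h) (hh_nonneg : ∀ x, 0 ≤ h x)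
    (hh2 : Integrable (fun x => h x ^ 2 * p_d x))
    (Z : ℝ) (hZdef : Z = ∫ x, h x * p_d x) (hZpos : 0 < Z)
    (μ : Measure (Fin n → ℝ))
    (hμ : μ = volume.withDensity (fun x => ENNReal.ofReal (p_d x))) :
    (∫ x, h x ^ 2 * p_d x) - (∫ x, h x * p_d x) ^ 2 = variance h μ ∧
    0 ≤ variance h μ ∧
    (variance h μ = 0 ↔ h =ᵐ[μ] fun _ => Z) ∧
    (∫ x, h x ^ 2 * p_d x ^ 2 / p_d x) - (∫ x, h x ^ 2 * p_d x ^ 2 / (h x * p_d x / Z))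
      = variance h μ ∧
    (0 < (∫ x, h x ^ 2 * p_d x ^ 2 / p_d x)
          - (∫ x, h x ^ 2 * p_d x ^ 2 / (h x * p_d x / Z)) ↔
      ¬ ∃ c : ℝ, h =ᵐ[μ] fun _ => c) := by
  obtain ⟨hp_meas, hp_nonneg, hp_one⟩ := hpd
  have hprob : IsProbabilityMeasure μ := ⟨by simp [hμ, hp_one]⟩
  have hint : ∀ f : (Fin n → ℝ) → ℝ, ∫ x, f x ∂μ = ∫ x, f x * p_d x := fun f ↦ by
    rw [hμ, integral_withDensity_eq_integral_toReal_smul hp_meas.ennreal_ofReal (by simp)]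
    simp [ENNReal.toReal_ofReal (hp_nonneg _), mul_comm]
  have hL2 : MemLp h 2 μ := by
    rw [memLp_two_iff_integrable_sq hh_meas.aestronglyMeasurable, hμ,
      integrable_withDensity_iff hp_meas.ennreal_ofReal (by simp)]
    simpa [ENNReal.toReal_ofReal (hp_nonneg _)] using hh2
  have hmean : ∫ x, h x ∂μ = Z := by rw [hint, hZdef]
  have hvar : (∫ x, h x ^ 2 * p_d x) - (∫ x, h x * p_d x) ^ 2 = variance h μ := by
    rw [variance_eq_sub hL2, ← hint, ← hint]
    rfl
  have hzero : variance h μ = 0 ↔ h =ᵐ[μ] fun _ ↦ Z := by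
    rw [← hmean, ← evariance_eq_zero_iff hh_meas.aemeasurable, variance,
      ENNReal.toReal_eq_zero_iff, or_iff_left hL2.evariance_lt_top.ne]
  have hdata : ∫ x, h x ^ 2 * p_d x ^ 2 / p_d x = ∫ x, h x ^ 2 * p_d x := by
    congr 1 with x
    by_cases hp : p_d x = 0
    · simp [hp]
    · field_simp
  have hopt : ∫ x, h x ^ 2 * p_d x ^ 2 / (h x * p_d x / Z) = Z ^ 2 := by
    have hpt : ∀ x, h x ^ 2 * p_d x ^ 2 / (h x * p_d x / Z) = Z * (h x * p_d x) := fun x ↦ by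
      by_cases hp : p_d x = 0
      · simp [hp]
      by_cases hhx : h x = 0
      · simp [hhx]
      · field_simp
    simp_rw [hpt]
    rw [integral_const_mul, ← hZdef, sq]
  have hgap : (∫ x, h x ^ 2 * p_d x ^ 2 / p_d x)
      - (∫ x, h x ^ 2 * p_d x ^ 2 / (h x * p_d x / Z)) = variance h μ := by
    rw [hdata, hopt, ← hvar, ← hZdef]
  refine ⟨hvar, variance_nonneg h μ, hzero, hgap, ?_⟩
  rw [hgap, (variance_nonneg h μ).lt_iff_ne', Ne, hzero, not_iff_not]
  refine ⟨fun hc ↦ ⟨Z, hc⟩, fun ⟨c, hc⟩ ↦ ?_⟩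
  have hcZ : c = Z := by rw [← hmean, integral_congr_ae hc]; simp
  rwa [← hcZ]
end

section
/- Let p_d be a probability density on ℝ^n, let g : ℝ^n → ℝ^k be measurable with g componentwise integrable against p_d and ∫ g(x) p_d(x) dx = 0, and suppose I_F := ∫ g(x) g(x)ᵀ p_d(x) dx (entrywise) is an invertible matrix with tr(I_F⁻¹) > 0. Fix a computational budget T > 0, take the noise equal to the data, p_n = p_d, and for ν > 0 define the discriminator weight 1 − D(x) := ν p_d(x)/(p_d(x) + ν p_d(x)), m(ν) := ∫ g(x)(1 − D(x)) p_d(x) dx and I(ν) := ∫ g(x)g(x)ᵀ (1 − D(x)) p_d(x) dx. Then m(ν) = 0, I(ν) = (ν/(1+ν)) I_F, and the asymptotic mean-squared error MSE(ν) := ((ν+1)/T) tr(I(ν)⁻¹ − ((ν+1)/ν) I(ν)⁻¹ m(ν) m(ν)ᵀ I(ν)⁻¹) equals ((ν+1)²/(ν T)) tr(I_F⁻¹). Moreover, MSE(ν) ≥ MSE(1) = 4 tr(I_F⁻¹)/T for every ν > 0, with equality if and only if ν = 1; that is, when the noise distribution equals the data distribution, the optimal noise-data ratio under a fixed budget is ν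 = 1 (noise proportion 50%). -/
open MeasureTheory Matrix

theorem discriminator_weight_mul {ν p w : ℝ} (hν : 0 < ν) (hw : w = ν * p / (p + ν * p)) :
    w * p = ν / (1 + ν) * p := by
  have h1 : (1 + ν) ≠ 0 := by positivity
  rcases eq_or_ne p 0 with rfl | hp
  · simp
  · have h2 : p + ν * p ≠ 0 := by
      rw [show p + ν * p = (1 + ν) * p by ring]
      exact mul_ne_zero h1 hp
    rw [hw]
    field_simp

theorem inv_smul_of_isUnit_det {k : ℕ} {A : Matrix (Fin k) (Fin k) ℝ} (hA : IsUnit A.det)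
    {c : ℝ} (hc : c ≠ 0) : (c • A)⁻¹ = c⁻¹ • A⁻¹ := by
  apply Matrix.inv_eq_right_inv
  rw [Matrix.smul_mul, Matrix.mul_smul, smul_smul, Matrix.mul_nonsing_inv A hA,
    mul_inv_cancel₀ hc, one_smul]

/-- When the NCE noise equals the data distribution: the discriminator-weighted score
mean `m(ν)` vanishes, the weighted score covariance is `I(ν) = (ν/(1+ν)) I_F`, the
asymptotic MSE under budget `T` is `((ν+1)²/(ν T)) tr(I_F⁻¹)`, and this is minimized
over `ν > 0` exactly at `ν = 1` (noise proportion 50%), with `MSE(1) = 4 tr(I_F⁻¹)/T`. -/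
theorem stmt_5 {n k : ℕ} (p_d : (Fin n → ℝ) → ℝ) (hpd : IsProbDensity p_d)
    (g : (Fin n → ℝ) → Fin k → ℝ) (hg : Measurable g)
    (hgint : ∀ i, Integrable (fun x => g x i * p_d x))
    (hgmean : ∀ i, ∫ x, g x i * p_d x = 0)
    (I_F : Matrix (Fin k) (Fin k) ℝ)
    (hIFint : ∀ i j, Integrable (fun x => g x i * g x j * p_d x))
    (hIF : ∀ i j, I_F i j = ∫ x, g x i * g x j * p_d x)
    (hIFinv : IsUnit I_F.det) (htr : 0 < I_F⁻¹.trace)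
    (T : ℝ) (hT : 0 < T)
    (D : ℝ → (Fin n → ℝ) → ℝ)
    (hD : ∀ ν x, 1 - D ν x = ν * p_d x / (p_d x + ν * p_d x))
    (m : ℝ → Fin k → ℝ)
    (hm : ∀ ν i, m ν i = ∫ x, g x i * (1 - D ν x) * p_d x)
    (Imat : ℝ → Matrix (Fin k) (Fin k) ℝ)
    (hImat : ∀ ν i j, Imat ν i j = ∫ x, g x i * g x j * (1 - D ν x) * p_d x)
    (MSE : ℝ → ℝ)
    (hMSE : ∀ ν, MSE ν = ((ν + 1) / T) *
      Matrix.trace ((Imat ν)⁻¹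
        - ((ν + 1) / ν) • ((Imat ν)⁻¹ * Matrix.vecMulVec (m ν) (m ν) * (Imat ν)⁻¹))) :
    ∀ ν : ℝ, 0 < ν →
      (∀ i, m ν i = 0) ∧
      Imat ν = (ν / (1 + ν)) • I_F ∧
      MSE ν = ((ν + 1) ^ 2 / (ν * T)) * I_F⁻¹.trace ∧
      MSE 1 = 4 * I_F⁻¹.trace / T ∧
      MSE 1 ≤ MSE ν ∧
      (MSE ν = MSE 1 ↔ ν = 1) := by
  have weight : ∀ ν : ℝ, 0 < ν → ∀ (f : (Fin n → ℝ) → ℝ),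
      ∫ x, f x * (1 - D ν x) * p_d x = ν / (1 + ν) * ∫ x, f x * p_d x := by
    intro ν hν f
    rw [← integral_const_mul]
    congr 1 with x
    rw [mul_assoc, discriminator_weight_mul hν (hD ν x)]
    ring
  have mean_zero : ∀ ν : ℝ, 0 < ν → ∀ i, m ν i = 0 := fun ν hν i => by
    rw [hm, weight ν hν (fun x => g x i), hgmean, mul_zero]
  have cov : ∀ ν : ℝ, 0 < ν → Imat ν = (ν / (1 + ν)) • I_F := fun ν hν => by
    ext i j
    rw [hImat, weight ν hν (fun x => g x i * g x j), Matrix.smul_apply, hIF, smul_eq_mul]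
  have mse : ∀ ν : ℝ, 0 < ν → MSE ν = ((ν + 1) ^ 2 / (ν * T)) * I_F⁻¹.trace := fun ν hν => by
    have hc : ν / (1 + ν) ≠ 0 := by positivity
    have hm0 : m ν = 0 := funext (mean_zero ν hν)
    rw [hMSE, hm0, Matrix.vecMulVec_zero, Matrix.mul_zero, Matrix.zero_mul, smul_zero, sub_zero,
      cov ν hν, inv_smul_of_isUnit_det hIFinv hc, Matrix.trace_smul, smul_eq_mul]
    field_simp
    ring
  intro ν hν
  have mse_one : MSE 1 = 4 * I_F⁻¹.trace / T := by
    rw [mse 1 one_pos]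
    ring
  have gap : MSE ν - MSE 1 = (ν - 1) ^ 2 * (I_F⁻¹.trace / (ν * T)) := by
    rw [mse ν hν, mse_one]
    field_simp
    ring
  have hpos : 0 < I_F⁻¹.trace / (ν * T) := by positivity
  refine ⟨mean_zero ν hν, cov ν hν, mse ν hν, mse_one, ?_, ?_⟩
  · rw [← sub_nonneg, gap]
    positivity
  · rw [← sub_eq_zero, gap, mul_eq_zero_iff_right hpos.ne', sq_eq_zero_iff, sub_eq_zero]
end

section
/- Let p_d and p_n be probability densities on ℝ^n with p_d(x) > 0 for almost every x and with s(x) := p_n(x)/p_d(x) essentially bounded. Let f : ℝ^n → ℝ be measurable with f·p_n Lebesgue-integrable. Then the function G(ν) := ∫ f(x) p_d(x) · (ν p_n(x)/(p_d(x) + ν p_n(x))) dx satisfies G(0) = 0 and is differentiable at ν = 0 with G′(0) = ∫ f(x) p_n(x) dx. -/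
open MeasureTheory

/-- The `ν`-derivative of the weighted integrand `a * d * (ν b / (d + ν b))`. -/
theorem hasDerivAt_mul_div_add (a d b ν : ℝ) (h : d + ν * b ≠ 0) :
    HasDerivAt (fun ν : ℝ => a * d * (ν * b / (d + ν * b)))
      (a * d * (b * d / (d + ν * b) ^ 2)) ν := by
  have h1 : HasDerivAt (fun ν : ℝ => ν * b) b ν := by
    simpa using (hasDerivAt_id ν).mul_const b
  have h2 : b * d / (d + ν * b) ^ 2 =
      (b * (d + ν * b) - ν * b * b) / (d + ν * b) ^ 2 := by ring
  rw [h2]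
  exact (h1.div (h1.const_add d) h).const_mul (a * d)

/-- For `|ν|` small against the bound on `b / d`, the denominator stays above `d / 2`. -/
theorem half_le_add_mul {d b M ν : ℝ} (hd : 0 < d) (hb : 0 ≤ b) (hM : b / d ≤ M)
    (hν : |ν| < 1 / (2 * (|M| + 1))) : d / 2 ≤ d + ν * b := by
  have hK : 0 < |M| + 1 := by positivity
  have hbK : b ≤ (|M| + 1) * d :=
    (div_le_iff₀ hd).1 (hM.trans ((le_abs_self M).trans (by linarith)))
  have hνK : |ν| * (|M| + 1) ≤ 1 / 2 := by
    rw [lt_div_iff₀ (by positivity)] at hν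
    linarith
  have h1 : |ν| * b ≤ 1 / 2 * d := calc
    |ν| * b ≤ |ν| * ((|M| + 1) * d) := by gcongr
    _ = |ν| * (|M| + 1) * d := by ring
    _ ≤ 1 / 2 * d := by gcongr
  have h2 : -|ν| * b ≤ ν * b := mul_le_mul_of_nonneg_right (neg_abs_le ν) hb
  linarith

theorem norm_deriv_le {a d b e : ℝ} (hd : 0 < d) (he : d / 2 ≤ e) :
    ‖a * d * (b * d / e ^ 2)‖ ≤ 4 * ‖a * b‖ := by
  have he0 : 0 < e := by linarith
  have h : d ^ 2 / e ^ 2 ≤ 4 := by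
    rw [div_le_iff₀ (by positivity)]
    nlinarith
  have h0 : 0 ≤ d ^ 2 / e ^ 2 := by positivity
  calc ‖a * d * (b * d / e ^ 2)‖ = ‖d ^ 2 / e ^ 2 * (a * b)‖ := by congr 1; ring
    _ = d ^ 2 / e ^ 2 * ‖a * b‖ := by rw [norm_mul, Real.norm_of_nonneg h0]
    _ ≤ 4 * ‖a * b‖ := by gcongr

/-- All-data limit differentiation: if `p_d > 0` a.e., `s = p_n/p_d` is essentially
bounded by `M`, and `f · p_n` is integrable, then
`G(ν) = ∫ f p_d · (ν p_n / (p_d + ν p_n))` satisfies `G(0) = 0` and is differentiable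
at `ν = 0` with `G′(0) = ∫ f p_n`. Division by zero is interpreted as `0`. -/
theorem stmt_8 {n : ℕ} (p_d p_n : (Fin n → ℝ) → ℝ)
    (hpd : IsProbDensity p_d) (hpn : IsProbDensity p_n)
    (hpd_pos : ∀ᵐ x ∂volume, 0 < p_d x)
    (M : ℝ) (hM : ∀ᵐ x ∂volume, p_n x / p_d x ≤ M)
    (f : (Fin n → ℝ) → ℝ) (hf : Measurable f)
    (hfint : Integrable (fun x => f x * p_n x)) :
    (∫ x, f x * p_d x * (0 * p_n x / (p_d x + 0 * p_n x))) = 0 ∧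
    HasDerivAt (fun ν : ℝ => ∫ x, f x * p_d x * (ν * p_n x / (p_d x + ν * p_n x)))
      (∫ x, f x * p_n x) 0 := by
  refine ⟨by simp, ?_⟩
  obtain ⟨hdm, -, -⟩ := hpd
  obtain ⟨hnm, hn0, -⟩ := hpn
  have hderiv : (∫ x, f x * p_n x) =
      ∫ x, f x * p_d x * (p_n x * p_d x / (p_d x + 0 * p_n x) ^ 2) := by
    refine integral_congr_ae ?_
    filter_upwards [hpd_pos] with x hx
    rw [zero_mul, add_zero]
    field_simp
  rw [hderiv]
  have hball : ∀ ν ∈ Metric.ball (0 : ℝ) (1 / (2 * (|M| + 1))),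
      |ν| < 1 / (2 * (|M| + 1)) := fun ν hν => by simpa using hν
  refine (hasDerivAt_integral_of_dominated_loc_of_deriv_le
    (F' := fun ν x => f x * p_d x * (p_n x * p_d x / (p_d x + ν * p_n x) ^ 2))
    (bound := fun x => 4 * ‖f x * p_n x‖)
    (Metric.ball_mem_nhds 0 (by positivity : 0 < 1 / (2 * (|M| + 1))))
    (.of_forall fun ν => ?_) (by simp) ?_ ?_ (hfint.norm.const_mul 4) ?_).2
  · exact Measurable.aestronglyMeasurable (by fun_prop)
  · exact Measurable.aestronglyMeasurable (by fun_prop)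
  · filter_upwards [hpd_pos, hM] with x hx hMx ν hν
    exact norm_deriv_le hx (half_le_add_mul hx (hn0 x) hMx (hball ν hν))
  · filter_upwards [hpd_pos, hM] with x hx hMx ν hν
    have := half_le_add_mul hx (hn0 x) hMx (hball ν hν)
    exact hasDerivAt_mul_div_add _ _ _ _ (ne_of_gt (by linarith))
end

section
/- Fix θ > 0 and let p_θ(x) = (2πθ)^{−1/2} e^{−x²/(2θ)} be the zero-mean Gaussian density with variance θ on ℝ. Let Z := ∫ p_θ(x) |x² − θ| dx, which is finite and strictly positive. Then p_n^opt(x) := p_θ(x) |x² − θ| / Z is a probability density on ℝ, and for every probability density p_n on ℝ with p_n(x) > 0 for almost every x, ∫ (x² − θ)² p_θ(x)² / p_n(x) dx ≥ ∫ (x² − θ)² p_θ(x)² / p_n^opt(x) dx = Z²; that is, the optimal NCE noise for estimating a Gaussian variance in the all-noise limit is p_n^opt(x) ∝ (2πθ)^{−1/2} e^{−x²/(2θ)} |x² − θ|, which is highly non-Gaussian unlike the data distribution. -/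
open MeasureTheory

/-- A probability density on ℝ: a nonnegative Lebesgue-measurable function whose
Lebesgue integral equals 1. -/
def IsProbDensityR (p : ℝ → ℝ) : Prop :=
  Measurable p ∧ (∀ x, 0 ≤ p x) ∧ ∫⁻ x, ENNReal.ofReal (p x) = 1

/-- The integral lower bound behind importance sampling: `∫ h² / p ≥ (∫ h)²` for every
a.e. positive probability density `p`. -/
lemma ofReal_sq_integral_le_lintegral_sq_div_s17 {h p : ℝ → ℝ} (hint : Integrable h)
    (h_nonneg : ∀ x, 0 ≤ h x) (hp : IsProbDensityR p) (hpos : ∀ᵐ x ∂volume, 0 < p x) :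
    ENNReal.ofReal ((∫ x, h x) ^ 2) ≤ ∫⁻ x, ENNReal.ofReal (h x ^ 2 / p x) := by
  obtain ⟨hpm, hp0, hp1⟩ := hp
  set Z := ∫ x, h x with hZ
  have hZ0 : 0 ≤ Z := integral_nonneg h_nonneg
  have lhs : ∫⁻ x, ENNReal.ofReal (2 * Z * h x) = ENNReal.ofReal (2 * Z ^ 2) := by
    rw [← ofReal_integral_eq_lintegral_ofReal (hint.const_mul _)
      (ae_of_all _ fun x => mul_nonneg (by positivity) (h_nonneg x)), integral_const_mul, ← hZ]
    ring_nf
  have mass : ∫⁻ x, ENNReal.ofReal (Z ^ 2 * p x) = ENNReal.ofReal (Z ^ 2) := by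
    simp_rw [ENNReal.ofReal_mul (sq_nonneg Z)]
    rw [lintegral_const_mul _ hpm.ennreal_ofReal, hp1, mul_one]
  have key : ENNReal.ofReal (2 * Z ^ 2)
      ≤ (∫⁻ x, ENNReal.ofReal (h x ^ 2 / p x)) + ENNReal.ofReal (Z ^ 2) := by
    rw [← lhs, ← mass, ← lintegral_add_right _ (hpm.const_mul _).ennreal_ofReal]
    refine lintegral_mono_ae ?_
    filter_upwards [hpos] with x hx
    rw [← ENNReal.ofReal_add (by positivity) (by positivity)]
    apply ENNReal.ofReal_le_ofReal
    have : h x ^ 2 / p x + Z ^ 2 * p x - 2 * Z * h x = (h x - Z * p x) ^ 2 / p x := by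
      field_simp
      ring
    have : 0 ≤ (h x - Z * p x) ^ 2 / p x := by positivity
    linarith
  rw [two_mul, ENNReal.ofReal_add (sq_nonneg Z) (sq_nonneg Z)] at key
  exact (ENNReal.add_le_add_iff_right ENNReal.ofReal_ne_top).1 key

/-- Normalizing a nonnegative measurable function of positive integral gives a density. -/
lemma isProbDensityR_div_integral {h : ℝ → ℝ} (hm : Measurable h) (hint : Integrable h)
    (h_nonneg : ∀ x, 0 ≤ h x) (hZ : 0 < ∫ x, h x) :
    IsProbDensityR (fun x => h x / ∫ y, h y) := by
  refine ⟨hm.div_const _, fun x => div_nonneg (h_nonneg x) hZ.le, ?_⟩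
  rw [← ofReal_integral_eq_lintegral_ofReal (hint.div_const _)
    (ae_of_all _ fun x => div_nonneg (h_nonneg x) hZ.le), integral_div, div_self hZ.ne',
    ENNReal.ofReal_one]

/-- The normalized density attains the lower bound `(∫ h)²`. -/
lemma lintegral_sq_div_div_integral {h : ℝ → ℝ} (hint : Integrable h)
    (h_nonneg : ∀ x, 0 ≤ h x) :
    ∫⁻ x, ENNReal.ofReal (h x ^ 2 / (h x / ∫ y, h y)) = ENNReal.ofReal ((∫ x, h x) ^ 2) := by
  have hpt : ∀ x, h x ^ 2 / (h x / ∫ y, h y) = h x * ∫ y, h y := by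
    intro x
    rcases eq_or_ne (h x) 0 with hx | hx
    · simp [hx]
    · rw [div_div_eq_mul_div]
      field_simp
  simp_rw [hpt]
  rw [← ofReal_integral_eq_lintegral_ofReal (hint.mul_const _)
    (ae_of_all _ fun x => mul_nonneg (h_nonneg x) (integral_nonneg h_nonneg)),
    integral_mul_const, sq]

lemma integrable_gaussian_mul_abs_sq_sub (c θ : ℝ) (hθ : 0 < θ) :
    Integrable (fun x : ℝ => c * Real.exp (-x ^ 2 / (2 * θ)) * |x ^ 2 - θ|) := by
  have hb : 0 < 1 / (2 * θ) := by positivity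
  have h2 : Integrable fun x : ℝ => x ^ 2 * Real.exp (-(1 / (2 * θ)) * x ^ 2) := by
    simpa using integrable_rpow_mul_exp_neg_mul_sq hb (s := 2) (by norm_num)
  have h0 : Integrable fun x : ℝ => Real.exp (-(1 / (2 * θ)) * x ^ 2) :=
    integrable_exp_neg_mul_sq hb
  refine ((h2.sub (h0.const_mul θ)).abs.const_mul c).congr (ae_of_all _ fun x => ?_)
  have hexp : -(1 / (2 * θ)) * x ^ 2 = -x ^ 2 / (2 * θ) := by ring
  simp only [Pi.sub_apply, hexp]
  rw [← sub_mul, abs_mul, Real.abs_exp]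
  ring

/-- Optimal NCE noise for estimating a Gaussian variance in the all-noise limit:
with `p_θ(x) = (2πθ)^{−1/2} e^{−x²/(2θ)}` and `Z = ∫ p_θ |x² − θ|` (finite and
positive), `p_n^opt = p_θ |x² − θ| / Z` is a probability density, achieves
`∫ (x² − θ)² p_θ²/p_n^opt = Z²`, and every probability density `p_n` positive a.e.
satisfies `∫ (x² − θ)² p_θ²/p_n ≥ Z²`. Division by zero is interpreted as `0`. -/
theorem stmt_17 (θ : ℝ) (hθ : 0 < θ)
    (pθ : ℝ → ℝ)
    (hpθ : ∀ x, pθ x = (Real.sqrt (2 * Real.pi * θ))⁻¹ * Real.exp (-x ^ 2 / (2 * θ)))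
    (Z : ℝ) (hZ : Z = ∫ x, pθ x * |x ^ 2 - θ|) :
    Integrable (fun x => pθ x * |x ^ 2 - θ|) ∧ 0 < Z ∧
    IsProbDensityR (fun x => pθ x * |x ^ 2 - θ| / Z) ∧
    (∫⁻ x, ENNReal.ofReal ((x ^ 2 - θ) ^ 2 * pθ x ^ 2 / (pθ x * |x ^ 2 - θ| / Z)))
      = ENNReal.ofReal (Z ^ 2) ∧
    ∀ p_n : ℝ → ℝ, IsProbDensityR p_n → (∀ᵐ x ∂volume, 0 < p_n x) →
      ENNReal.ofReal (Z ^ 2)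
        ≤ ∫⁻ x, ENNReal.ofReal ((x ^ 2 - θ) ^ 2 * pθ x ^ 2 / p_n x) := by
  have hθpos : ∀ x, 0 < pθ x := fun x => by
    rw [hpθ]
    have := Real.pi_pos
    positivity
  have h_nonneg : ∀ x, 0 ≤ pθ x * |x ^ 2 - θ| := fun x =>
    mul_nonneg (hθpos x).le (abs_nonneg _)
  have hcont : Continuous fun x => pθ x * |x ^ 2 - θ| := by
    simp_rw [hpθ]
    fun_prop
  have hint : Integrable fun x => pθ x * |x ^ 2 - θ| := by
    simp_rw [hpθ]
    exact integrable_gaussian_mul_abs_sq_sub _ θ hθ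
  have hpos : 0 < ∫ x, pθ x * |x ^ 2 - θ| := by
    refine integral_pos_of_integrable_nonneg_nonzero (x := 0) hcont hint h_nonneg ?_
    exact mul_ne_zero (hθpos 0).ne' (by simpa using hθ.ne')
  have hsq : ∀ x, (x ^ 2 - θ) ^ 2 * pθ x ^ 2 = (pθ x * |x ^ 2 - θ|) ^ 2 := fun x => by
    rw [mul_pow, sq_abs, mul_comm]
  subst hZ
  simp_rw [hsq]
  exact ⟨hint, hpos, isProbDensityR_div_integral hcont.measurable hint h_nonneg hpos,
    lintegral_sq_div_div_integral hint h_nonneg,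
    fun p_n hp hp_pos => ofReal_sq_integral_le_lintegral_sq_div_s17 hint h_nonneg hp hp_pos⟩
end
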